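/- arXiv:1504.07140 — 5 statements merged into one kernel-verified Lean document; each statement's English description precedes it below -/
import Mathlib

section
/- For every integer n ≥ 6, there exists a tournament T on n vertices such that the rainbow connection number of T equals 2. -/
/-- A digraph is given by its arc relation `A`.  It is a tournament if it has no
loops and every two distinct vertices are joined by exactly one arc. -/
def IsTournament {V : Type*} (A : V → V → Prop) : Prop :=
  (∀ v : V, ¬ A v v) ∧ ∀ u v : V, u ≠ v → Xor' (A u v) (A v u)

/-- A (directed) path in the digraph `A`: a list of pairwise distinct vertices
in which every consecutive pair is an arc. -/
def IsDipath {V : Type*} (A : V → V → Prop) (l : List V) : Prop :=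
  l.Chain' A ∧ l.Nodup

/-- The arcs traversed by a path given as a list of vertices. -/
def pathArcs {V : Type*} (l : List V) : List (V × V) := l.zip l.tail

/-- A rainbow path for the arc-colouring `ρ`: a directed path no two of whose
arcs share the same colour. -/
def IsRainbowPath {V C : Type*} (A : V → V → Prop) (ρ : V → V → C) (l : List V) : Prop :=
  IsDipath A l ∧ ((pathArcs l).map (fun p => ρ p.1 p.2)).Nodup

/-- The digraph `A` is rainbow connected under the arc-colouring `ρ` if for every
ordered pair of vertices `u`, `v` there is a rainbow directed `uv`-path. -/
def RainbowConnected {V C : Type*} (A : V → V → Prop) (ρ : V → V → C) : Prop :=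
  ∀ u v : V, ∃ l : List V,
    l.head? = some u ∧ l.getLast? = some v ∧ IsRainbowPath A ρ l

/-- The rainbow connection number of the digraph `A`: the least number of colours
in an arc-colouring making `A` rainbow connected (`⊤` if there is none). -/
noncomputable def rc {V : Type*} (A : V → V → Prop) : ℕ∞ :=
  sInf {k : ℕ∞ | ∃ c : ℕ, k = (c : ℕ∞) ∧ ∃ ρ : V → V → Fin c, RainbowConnected A ρ}

/-- `M` encodes a tournament with two-coloured arcs (entry `0` meaning that there is no arc) in which
any two distinct vertices are joined by an arc or by a two-coloured path of length two. -/
def IsTwoRainbow {V : Type*} (M : V → V → Fin 3) : Prop :=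
  (∀ v, M v v = 0) ∧ (∀ u v, u ≠ v → (M u v = 0 ↔ M v u ≠ 0)) ∧
    ∀ u v, u ≠ v → M u v ≠ 0 ∨ ∃ w, M u w ≠ 0 ∧ M w v ≠ 0 ∧ M u w ≠ M w v

instance {V : Type*} [Fintype V] [DecidableEq V] (M : V → V → Fin 3) :
    Decidable (IsTwoRainbow M) := by
  unfold IsTwoRainbow
  infer_instance

theorem IsTwoRainbow.comp_equiv {V W : Type*} {M : V → V → Fin 3} (h : IsTwoRainbow M)
    (e : W ≃ V) : IsTwoRainbow fun u v => M (e u) (e v) := by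
  obtain ⟨h₁, h₂, h₃⟩ := h
  refine ⟨fun v => h₁ _, fun u v huv => h₂ _ _ (e.injective.ne huv), fun u v huv => ?_⟩
  refine (h₃ _ _ (e.injective.ne huv)).imp_right ?_
  rintro ⟨w, hw⟩
  exact ⟨e.symm w, by simpa using hw⟩

/-- The substitution of `M` for the vertex `none` of `G`. -/
def substNone {U V : Type*} (G : Option U → Option U → Fin 3) (M : V → V → Fin 3) :
    U ⊕ V → U ⊕ V → Fin 3
  | .inl a, .inl b => G (some a) (some b)
  | .inl a, .inr _ => G (some a) none
  | .inr _, .inl b => G none (some b)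
  | .inr u, .inr v => M u v

theorem IsTwoRainbow.substNone {U V : Type*} [Nonempty V] {G : Option U → Option U → Fin 3}
    {M : V → V → Fin 3} (hG : IsTwoRainbow G) (hM : IsTwoRainbow M) :
    IsTwoRainbow (substNone G M) := by
  obtain ⟨g₁, g₂, g₃⟩ := hG
  obtain ⟨m₁, m₂, m₃⟩ := hM
  obtain ⟨x⟩ := ‹Nonempty V›
  refine ⟨?_, ?_, ?_⟩
  · rintro (a | u)
    exacts [g₁ _, m₁ _]
  · rintro (a | u) (b | v) huv
    · exact g₂ _ _ (by simpa using huv)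
    · exact g₂ _ _ (by simp)
    · exact g₂ _ _ (by simp)
    · exact m₂ _ _ (by simpa using huv)
  · rintro (a | u) (b | v) huv
    · refine (g₃ (some a) (some b) (by simpa using huv)).imp_right ?_
      rintro ⟨_ | c, hc⟩
      exacts [⟨.inr x, hc⟩, ⟨.inl c, hc⟩]
    · refine (g₃ (some a) none (by simp)).imp_right ?_
      rintro ⟨_ | c, hc⟩
      exacts [absurd (g₁ none) hc.2.1, ⟨.inl c, hc⟩]
    · refine (g₃ none (some b) (by simp)).imp_right ?_
      rintro ⟨_ | c, hc⟩
      exacts [absurd (g₁ none) hc.1, ⟨.inl c, hc⟩]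
    · refine (m₃ u v (by simpa using huv)).imp_right ?_
      rintro ⟨w, hw⟩
      exact ⟨.inr w, hw⟩

theorem exists_isTwoRainbow_six : ∃ M : Fin 6 → Fin 6 → Fin 3, IsTwoRainbow M :=
  ⟨![![0, 1, 2, 2, 0, 0],
     ![0, 0, 2, 0, 0, 1],
     ![0, 0, 0, 0, 1, 1],
     ![0, 2, 1, 0, 2, 0],
     ![1, 2, 0, 0, 0, 0],
     ![2, 0, 0, 2, 1, 0]],
    by decide +kernel⟩

theorem exists_isTwoRainbow_seven : ∃ M : Fin 7 → Fin 7 → Fin 3, IsTwoRainbow M :=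
  ⟨![![0, 0, 0, 0, 2, 1, 2],
     ![2, 0, 1, 0, 1, 0, 1],
     ![1, 0, 0, 0, 0, 1, 0],
     ![1, 2, 2, 0, 0, 0, 1],
     ![0, 0, 1, 2, 0, 1, 0],
     ![0, 2, 0, 2, 0, 0, 0],
     ![0, 0, 2, 0, 2, 1, 0]],
    by decide +kernel⟩

theorem exists_isTwoRainbow_eight : ∃ M : Fin 8 → Fin 8 → Fin 3, IsTwoRainbow M :=
  ⟨![![0, 0, 0, 2, 0, 1, 2, 0],
     ![2, 0, 1, 1, 0, 0, 2, 0],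
     ![1, 0, 0, 0, 1, 1, 0, 0],
     ![0, 0, 1, 0, 0, 1, 2, 2],
     ![1, 1, 0, 2, 0, 0, 0, 1],
     ![0, 2, 0, 0, 2, 0, 0, 2],
     ![0, 0, 2, 0, 1, 1, 0, 0],
     ![1, 1, 2, 0, 0, 0, 1, 0]],
    by decide +kernel⟩

theorem exists_isTwoRainbow_nine : ∃ M : Fin 9 → Fin 9 → Fin 3, IsTwoRainbow M :=
  ⟨![![0, 1, 1, 2, 2, 0, 0, 0, 0],
     ![0, 0, 0, 1, 0, 1, 0, 2, 2],
     ![0, 1, 0, 2, 0, 2, 2, 2, 0],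
     ![0, 0, 0, 0, 2, 1, 2, 0, 0],
     ![0, 1, 1, 0, 0, 0, 0, 0, 1],
     ![2, 0, 0, 0, 1, 0, 0, 1, 2],
     ![1, 2, 0, 0, 2, 1, 0, 1, 0],
     ![2, 0, 0, 2, 1, 0, 0, 0, 2],
     ![2, 0, 1, 1, 0, 0, 1, 0, 0]],
    by decide +kernel⟩

theorem exists_isTwoRainbow_ten : ∃ M : Fin 10 → Fin 10 → Fin 3, IsTwoRainbow M :=
  ⟨![![0, 1, 2, 0, 2, 0, 0, 0, 1, 1],
     ![0, 0, 0, 1, 1, 2, 1, 2, 0, 0],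
     ![0, 1, 0, 0, 0, 2, 1, 2, 0, 0],
     ![2, 0, 2, 0, 0, 1, 0, 1, 2, 0],
     ![0, 0, 2, 1, 0, 0, 0, 0, 1, 1],
     ![1, 0, 0, 0, 2, 0, 2, 2, 0, 1],
     ![2, 0, 0, 2, 2, 0, 0, 0, 1, 0],
     ![2, 0, 0, 0, 2, 0, 1, 0, 1, 0],
     ![0, 2, 2, 0, 0, 2, 0, 0, 0, 1],
     ![0, 2, 2, 2, 0, 0, 1, 2, 0, 0]],
    by decide +kernel⟩

theorem exists_isTwoRainbow (n : ℕ) (hn : 6 ≤ n) :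
    ∃ M : Fin n → Fin n → Fin 3, IsTwoRainbow M := by
  induction n using Nat.strong_induction_on with
  | _ n ih =>
    by_cases h : n ≤ 10
    · interval_cases n
      exacts [exists_isTwoRainbow_six, exists_isTwoRainbow_seven, exists_isTwoRainbow_eight,
        exists_isTwoRainbow_nine, exists_isTwoRainbow_ten]
    · obtain ⟨k, rfl⟩ : ∃ k, n = 5 + k := ⟨n - 5, by lia⟩
      have : Nonempty (Fin k) := ⟨⟨0, by lia⟩⟩
      obtain ⟨G, hG⟩ := exists_isTwoRainbow_six
      obtain ⟨M, hM⟩ := ih k (by lia) (by lia)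
      exact ⟨_, ((hG.comp_equiv (finSuccEquiv 5).symm).substNone hM).comp_equiv
        finSumFinEquiv.symm⟩

theorem IsTwoRainbow.isTournament {V : Type*} {M : V → V → Fin 3} (h : IsTwoRainbow M) :
    IsTournament fun u v => M u v ≠ 0 := by
  refine ⟨fun v hv => hv (h.1 v), fun u v huv => ?_⟩
  have := h.2.1 u v huv
  by_cases hv : M v u = 0
  · exact .inl ⟨fun hu => this.1 hu hv, not_not.2 hv⟩
  · exact .inr ⟨hv, not_not.2 (this.2 hv)⟩

theorem IsTwoRainbow.rainbowConnected {V : Type*} {M : V → V → Fin 3} (h : IsTwoRainbow M) :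
    RainbowConnected (fun u v => M u v ≠ 0)
      (fun u v => if M u v = 1 then (0 : Fin 2) else 1) := by
  intro u v
  by_cases huv : u = v
  · subst huv
    exact ⟨[u], rfl, rfl, ⟨.singleton _, by simp⟩, by simp [pathArcs]⟩
  obtain hA | ⟨w, hw₁, hw₂, hw⟩ := h.2.2 u v huv
  · exact ⟨[u, v], rfl, rfl, ⟨List.isChain_pair.2 hA, by simp [huv]⟩, by simp [pathArcs]⟩
  · have huw : u ≠ w := fun e => hw₁ (e ▸ h.1 u)
    have hwv : w ≠ v := fun e => hw₂ (e ▸ h.1 w)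
    refine ⟨[u, w, v], rfl, rfl, ⟨.cons_cons hw₁ (List.isChain_pair.2 hw₂), ?_⟩, ?_⟩
    · simp [huw, hwv, huv]
    · have key : ∀ a b : Fin 3, a ≠ 0 → b ≠ 0 → a ≠ b →
          (if a = 1 then (0 : Fin 2) else 1) ≠ if b = 1 then 0 else 1 := by decide
      simpa [pathArcs] using key _ _ hw₁ hw₂ hw

/-- A rainbow path with at most one colour available has at most one arc. -/
theorem RainbowConnected.adj_of_subsingleton {V C : Type*} [Subsingleton C] {A : V → V → Prop}
    {ρ : V → V → C} (h : RainbowConnected A ρ) {u v : V} (huv : u ≠ v) : A u v := by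
  obtain ⟨l, hu, hv, hl, hρ⟩ := h u v
  match l with
  | [] => simp at hu
  | [a] =>
    simp only [List.head?_cons, Option.some.injEq, List.getLast?_singleton] at hu hv
    exact absurd (hu.symm.trans hv) huv
  | [a, b] =>
    obtain rfl : a = u := by simpa using hu
    obtain rfl : b = v := by simpa using hv
    exact List.isChain_pair.1 hl.1
  | a :: b :: c :: l =>
    have hne : ρ a b ≠ ρ b c := by
      simp only [pathArcs, List.tail_cons, List.zip_cons_cons, List.map_cons,
        List.nodup_cons, List.mem_cons, not_or] at hρ
      exact hρ.1.1
    exact absurd (Subsingleton.elim _ _) hne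

theorem IsTournament.two_le_rc {V : Type*} [Nontrivial V] {A : V → V → Prop}
    (hA : IsTournament A) : 2 ≤ rc A := by
  refine le_sInf ?_
  rintro _ ⟨c, rfl, ρ, hρ⟩
  by_contra hc
  have hc' : c ≤ 1 := by
    by_contra! h
    exact hc (by exact_mod_cast h)
  have : Subsingleton (Fin c) := Fin.subsingleton_iff_le_one.2 hc'
  obtain ⟨u, v, huv⟩ := exists_pair_ne V
  have huv' := hρ.adj_of_subsingleton huv
  have hvu' := hρ.adj_of_subsingleton huv.symm
  obtain ⟨-, h⟩ | ⟨-, h⟩ := hA.2 u v huv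
  exacts [h hvu', h huv']

theorem rainbow_connection_two_of_six_le (n : ℕ) (hn : 6 ≤ n) :
    ∃ A : Fin n → Fin n → Prop, IsTournament A ∧ rc A = 2 := by
  obtain ⟨M, hM⟩ := exists_isTwoRainbow n hn
  have : Nontrivial (Fin n) := Fin.nontrivial_iff_two_le.2 (by lia)
  exact ⟨_, hM.isTournament, le_antisymm (sInf_le ⟨2, rfl, _, hM.rainbowConnected⟩)
    hM.isTournament.two_le_rc⟩
end

section
/- For every integer n ≥ 6 and every integer k with 2 ≤ k ≤ n − 1, there exists a tournament T on n vertices such that the rainbow connection number of T equals k. -/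
/-- A potential that grows by at most one along each arc grows along a directed path by at
most the number of arcs. -/
theorem le_add_length_pathArcs {V : Type*} {A : V → V → Prop} (f : V → ℕ)
    (hf : ∀ u v, A u v → f v ≤ f u + 1) (l : List V) (hl : l.IsChain A) (u v : V)
    (hu : l.head? = some u) (hv : l.getLast? = some v) :
    f v ≤ f u + (pathArcs l).length := by
  induction l generalizing u with
  | nil => simp at hu
  | cons a t ih =>
    obtain rfl : a = u := by simpa using hu
    cases t with
    | nil =>
      obtain rfl : a = v := by simpa using hv
      simp
    | cons b t =>
      rw [List.isChain_cons_cons] at hl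
      have h := ih hl.2 b rfl (by simpa using hv)
      have hab := hf a b hl.1
      simp only [pathArcs, List.length_zip, List.length_tail, List.length_cons] at h ⊢
      omega

theorem le_rc_of_potential {V : Type*} {A : V → V → Prop} (f : V → ℕ)
    (hf : ∀ u v, A u v → f v ≤ f u + 1) {u v : V} {k : ℕ} (huv : f u + k ≤ f v) :
    (k : ℕ∞) ≤ rc A := by
  refine le_sInf ?_
  rintro _ ⟨c, rfl, ρ, hρ⟩
  obtain ⟨l, hu, hv, ⟨hl, -⟩, hc⟩ := hρ u v
  have h₁ := le_add_length_pathArcs f hf l hl u v hu hv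
  have h₂ := hc.length_le_card
  rw [List.length_map, Fintype.card_fin] at h₂
  exact_mod_cast (by omega : k ≤ c)

theorem rc_le_of_rainbowConnected {V : Type*} {A : V → V → Prop} {k : ℕ} (ρ : V → V → Fin k)
    (h : RainbowConnected A ρ) : rc A ≤ k :=
  sInf_le ⟨k, rfl, ρ, h⟩

theorem isRainbowPath_singleton {V C : Type*} (A : V → V → Prop) (ρ : V → V → C) (u : V) :
    IsRainbowPath A ρ [u] := by
  simp [IsRainbowPath, IsDipath, List.Chain', pathArcs]

theorem isRainbowPath_pair {V C : Type*} {A : V → V → Prop} (ρ : V → V → C) {u v : V}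
    (huv : u ≠ v) (h : A u v) : IsRainbowPath A ρ [u, v] := by
  simp [IsRainbowPath, IsDipath, List.Chain', pathArcs, huv, h]

theorem isRainbowPath_triple {V C : Type*} {A : V → V → Prop} {ρ : V → V → C} {u v w : V}
    (huv : u ≠ v) (huw : u ≠ w) (hvw : v ≠ w) (h₁ : A u v) (h₂ : A v w)
    (hc : ρ u v ≠ ρ v w) : IsRainbowPath A ρ [u, v, w] := by
  simp [IsRainbowPath, IsDipath, List.Chain', pathArcs, *]

theorem isRainbowPath_quadruple {V C : Type*} {A : V → V → Prop} {ρ : V → V → C} {u v w x : V}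
    (huv : u ≠ v) (huw : u ≠ w) (hux : u ≠ x) (hvw : v ≠ w) (hvx : v ≠ x) (hwx : w ≠ x)
    (h₁ : A u v) (h₂ : A v w) (h₃ : A w x)
    (hc₁ : ρ u v ≠ ρ v w) (hc₂ : ρ u v ≠ ρ w x) (hc₃ : ρ v w ≠ ρ w x) :
    IsRainbowPath A ρ [u, v, w, x] := by
  simp [IsRainbowPath, IsDipath, List.Chain', pathArcs, *]

/-- The tournament on `n` vertices obtained from the path `0, 1, …, k` with all other arcs
directed backwards by replacing the last vertex by a transitive tournament. -/
def blowupArc (n k : ℕ) (u v : Fin n) : Prop :=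
  min v.1 k = min u.1 k + 1 ∨ min v.1 k + 2 ≤ min u.1 k ∨ (min u.1 k = min v.1 k ∧ u < v)

theorem isTournament_blowupArc (n k : ℕ) : IsTournament (blowupArc n k) := by
  refine ⟨fun v h => ?_, fun u v huv => ?_⟩
  · rcases h with h | h | h
    · omega
    · omega
    · exact lt_irrefl _ h.2
  · have : u.1 ≠ v.1 := fun h => huv (Fin.ext h)
    simp only [blowupArc, Xor', Xor, Fin.lt_def]
    omega

/-- Path arcs of the blow-up get distinct colours, and an arc going two levels back completes
a rainbow triangle. -/
def blowupColour (n k : ℕ) (hk : 0 < k) (u v : Fin n) : Fin k :=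
  ⟨(if min v.1 k = min u.1 k + 1 then min u.1 k else min v.1 k + 2) % k, Nat.mod_lt _ hk⟩

theorem exists_level_path {n k : ℕ} (hk : 0 < k) (d : ℕ) (u v : Fin n)
    (huv : min v.1 k = min u.1 k + (d + 1)) :
    ∃ t : List (Fin n), (u :: t).getLast? = some v ∧ (u :: t).IsChain (blowupArc n k) ∧
      (u :: t).map (fun w => min w.1 k) = List.range' (min u.1 k) (d + 2) ∧
      (pathArcs (u :: t)).map (fun p => (blowupColour n k hk p.1 p.2).1)
        = List.range' (min u.1 k) (d + 1) := by
  induction d generalizing u with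
  | zero =>
    refine ⟨[v], by simp, ?_, ?_, ?_⟩
    · simp [blowupArc, huv]
    · simp [List.range', huv]
    · have : min u.1 k < k := by omega
      simp [List.range', pathArcs, blowupColour, huv, Nat.mod_eq_of_lt this]
  | succ d ih =>
    obtain ⟨w, hw⟩ : ∃ w : Fin n, min w.1 k = min u.1 k + 1 :=
      ⟨⟨min u.1 k + 1, by omega⟩, by simp only; omega⟩
    obtain ⟨t, h₁, h₂, h₃, h₄⟩ := ih w (by omega)
    refine ⟨w :: t, by simpa using h₁, ?_, ?_, ?_⟩
    · exact List.isChain_cons_cons.2 ⟨Or.inl hw, h₂⟩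
    · rw [List.map_cons, h₃, hw]
      rfl
    · have : min u.1 k < k := by omega
      have hc : (blowupColour n k hk u w).1 = min u.1 k := by
        simp [blowupColour, hw, Nat.mod_eq_of_lt this]
      change (blowupColour n k hk u w).1 ::
        (pathArcs (w :: t)).map (fun p => (blowupColour n k hk p.1 p.2).1) = _
      rw [h₄, hc, hw]
      rfl

theorem rainbowConnected_blowup {n k : ℕ} (hk : 3 ≤ k) (hkn : k ≤ n - 1) :
    RainbowConnected (blowupArc n k) (blowupColour n k (by omega)) := by
  have level : ∀ i, i ≤ k → ∃ w : Fin n, min w.1 k = i := fun i hi =>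
    ⟨⟨i, by omega⟩, by simp only; omega⟩
  have ne : ∀ {x y : Fin n}, min x.1 k ≠ min y.1 k → x ≠ y := by
    rintro x y h rfl
    exact h rfl
  have fwd : ∀ {x y : Fin n}, min y.1 k = min x.1 k + 1 →
      (blowupColour n k (by omega) x y).1 = min x.1 k := by
    intro x y h
    have : min x.1 k < k := by omega
    simp [blowupColour, h, Nat.mod_eq_of_lt this]
  have bwd : ∀ {x y : Fin n}, min x.1 k = min y.1 k + 2 →
      (blowupColour n k (by omega) x y).1 = if min x.1 k = k then 0 else min x.1 k := by
    intro x y h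
    have h' : ¬ min y.1 k = min x.1 k + 1 := by omega
    simp only [blowupColour, if_neg h', ← h]
    split_ifs with h₀
    · rw [h₀, Nat.mod_self]
    · exact Nat.mod_eq_of_lt (by omega)
  intro u v
  by_cases huv : u = v
  · subst huv
    exact ⟨[u], rfl, rfl, isRainbowPath_singleton _ _ _⟩
  by_cases harc : blowupArc n k u v
  · exact ⟨[u, v], rfl, rfl, isRainbowPath_pair _ huv harc⟩
  have hval : u.1 ≠ v.1 := fun h => huv (Fin.ext h)
  rcases lt_trichotomy (min u.1 k) (min v.1 k) with h | h | h
  · obtain ⟨t, h₁, h₂, h₃, h₄⟩ := exists_level_path (k := k) (by omega)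
      (min v.1 k - min u.1 k - 1) u v (by omega)
    refine ⟨u :: t, rfl, h₁, ⟨h₂, ?_⟩, ?_⟩
    · exact List.Nodup.of_map (fun w : Fin n => min w.1 k) (h₃ ▸ List.nodup_range')
    · refine List.Nodup.of_map Fin.val ?_
      rw [List.map_map]
      exact h₄ ▸ List.nodup_range'
  · obtain ⟨a, ha⟩ := level (k - 2) (by omega)
    obtain ⟨b, hb⟩ := level (k - 1) (by omega)
    have hu : min u.1 k = k := by omega
    have c₁ := bwd (x := u) (y := a) (by omega)
    have c₂ := fwd (x := a) (y := b) (by omega)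
    have c₃ := fwd (x := b) (y := v) (by omega)
    rw [if_pos hu] at c₁
    refine ⟨[u, a, b, v], rfl, rfl, isRainbowPath_quadruple (ne (by omega)) (ne (by omega)) huv
      (ne (by omega)) (ne (by omega)) (ne (by omega)) (Or.inr (Or.inl (by omega)))
      (Or.inl (by omega)) (Or.inl (by omega)) ?_ ?_ ?_⟩ <;>
    · rw [Ne, Fin.ext_iff]
      omega
  · have huv1 : min u.1 k = min v.1 k + 1 := by
      simp only [blowupArc] at harc
      omega
    by_cases hvk : min v.1 k + 2 ≤ k
    · obtain ⟨a, ha⟩ := level (min v.1 k + 2) hvk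
      have c₁ := fwd (x := u) (y := a) (by omega)
      have c₂ := bwd (x := a) (y := v) (by omega)
      refine ⟨[u, a, v], rfl, rfl, isRainbowPath_triple (ne (by omega)) huv (ne (by omega))
        (Or.inl (by omega)) (Or.inr (Or.inl (by omega))) ?_⟩
      rw [Ne, Fin.ext_iff]
      split_ifs at c₂ <;> omega
    · obtain ⟨a, ha⟩ := level (k - 2) (by omega)
      have c₁ := bwd (x := u) (y := a) (by omega)
      have c₂ := fwd (x := a) (y := v) (by omega)
      refine ⟨[u, a, v], rfl, rfl, isRainbowPath_triple (ne (by omega)) huv (ne (by omega))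
        (Or.inr (Or.inl (by omega))) (Or.inl (by omega)) ?_⟩
      rw [Ne, Fin.ext_iff]
      split_ifs at c₁ <;> omega

theorem rc_blowupArc {n k : ℕ} (hk : 3 ≤ k) (hkn : k ≤ n - 1) :
    rc (blowupArc n k) = k := by
  refine le_antisymm (rc_le_of_rainbowConnected _ (rainbowConnected_blowup hk hkn)) ?_
  refine le_rc_of_potential (fun w : Fin n => min w.1 k) ?_
    (u := ⟨0, by omega⟩) (v := ⟨k, by omega⟩) (by simp)
  intro u v h
  simp only [blowupArc] at h
  omega

/-- The arc-colouring `ρ` joins every two vertices by an arc or a rainbow path with two arcs. -/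
def TwoStepRainbow {V C : Type*} (A : V → V → Prop) (ρ : V → V → C) : Prop :=
  ∀ u v : V, u ≠ v → A u v ∨ ∃ w, A u w ∧ A w v ∧ ρ u w ≠ ρ w v

theorem TwoStepRainbow.rainbowConnected {V C : Type*} {A : V → V → Prop} {ρ : V → V → C}
    (hA : IsTournament A) (h : TwoStepRainbow A ρ) : RainbowConnected A ρ := by
  have ne : ∀ {x y : V}, A x y → x ≠ y := by
    rintro x y hxy rfl
    exact hA.1 _ hxy
  intro u v
  by_cases huv : u = v
  · subst huv
    exact ⟨[u], rfl, rfl, isRainbowPath_singleton _ _ _⟩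
  · rcases h u v huv with h | ⟨w, h₁, h₂, hc⟩
    · exact ⟨[u, v], rfl, rfl, isRainbowPath_pair _ huv h⟩
    · exact ⟨[u, w, v], rfl, rfl, isRainbowPath_triple (ne h₁) huv (ne h₂) h₁ h₂ hc⟩

/-- There is a tournament on `V` with a two-step rainbow 2-colouring in which some vertex
has an outgoing and an incoming arc of colour `false`. -/
def HasTwoColouring (V : Type) : Prop :=
  ∃ (A : V → V → Prop) (ρ : V → V → Bool), IsTournament A ∧ TwoStepRainbow A ρ ∧
    ∃ q a b, A q a ∧ ρ q a = false ∧ A b q ∧ ρ b q = false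

/-- Extension of a tournament by `x = inr false` and `y = inr true`, where `y → x`, and
`x → p → y` for all old vertices `p` except that `y → q → x`. -/
def extendArc {V : Type} (A : V → V → Prop) (q : V) : V ⊕ Bool → V ⊕ Bool → Prop
  | .inl u, .inl v => A u v
  | .inl u, .inr false => u = q
  | .inl u, .inr true => u ≠ q
  | .inr false, .inl v => v ≠ q
  | .inr true, .inl v => v = q
  | .inr i, .inr j => i = true ∧ j = false

open Classical in
/-- The colouring going with `extendArc`; `a` is the only vertex with `x → a` of colour
`false`. -/
noncomputable def extendColour {V : Type} (ρ : V → V → Bool) (a : V) : V ⊕ Bool → V ⊕ Bool → Bool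
  | .inl u, .inl v => ρ u v
  | .inl _, .inr _ => true
  | .inr false, .inl v => if v = a then false else true
  | .inr true, .inl _ => true
  | .inr _, .inr _ => false

theorem isTournament_extendArc {V : Type} {A : V → V → Prop} (hA : IsTournament A) (q : V) :
    IsTournament (extendArc A q) := by
  refine ⟨?_, ?_⟩
  · rintro (v | _ | _)
    · exact hA.1 v
    · simp [extendArc]
    · simp [extendArc]
  · rintro (u | _ | _) (v | _ | _) huv
    · exact hA.2 u v (fun h => huv (congrArg _ h))
    all_goals simp_all [extendArc, Xor', Xor, Classical.em, or_comm (a := ¬ _)]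

theorem HasTwoColouring.extend {V : Type} (h : HasTwoColouring V) :
    HasTwoColouring (V ⊕ Bool) := by
  obtain ⟨A, ρ, hA, hρ, q, a, b, hqa, cqa, hbq, cbq⟩ := h
  have hne : ∀ {x y : V}, A x y → x ≠ y := by
    rintro x y hxy rfl
    exact hA.1 _ hxy
  have haq : a ≠ q := (hne hqa).symm
  have hb : b ≠ q := hne hbq
  have hba : b ≠ a := by
    rintro rfl
    rcases hA.2 _ _ hb with h | h
    · exact h.2 hqa
    · exact h.2 hbq
  refine ⟨extendArc A q, extendColour ρ a, isTournament_extendArc hA q, ?_,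
    .inl q, .inl a, .inl b, hqa, cqa, hbq, cbq⟩
  rintro (u | _ | _) (v | _ | _) huv
  · rcases hρ u v (fun h => huv (congrArg _ h)) with h | ⟨w, h⟩
    · exact Or.inl h
    · exact Or.inr ⟨.inl w, h⟩
  · by_cases hu : u = q
    · exact Or.inl hu
    · exact Or.inr ⟨.inr true, by simp [extendArc, extendColour, hu]⟩
  · by_cases hu : u = q
    · subst hu
      exact Or.inr ⟨.inl a, hqa, haq, by simp [extendColour, cqa]⟩
    · exact Or.inl hu
  · by_cases hv : v = q
    · subst hv
      exact Or.inr ⟨.inl b, hb, hbq, by simp [extendColour, cbq, hba]⟩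
    · exact Or.inl hv
  · exact absurd rfl huv
  · exact Or.inr ⟨.inl a, by simp [extendArc, extendColour, haq]⟩
  · by_cases hv : v = q
    · exact Or.inl hv
    · by_cases hva : v = a
      · subst hva
        exact Or.inr ⟨.inl q, rfl, hqa, by simp [extendColour, cqa]⟩
      · exact Or.inr ⟨.inr false, by simp [extendArc, extendColour, hv, hva]⟩
  · exact Or.inl ⟨rfl, rfl⟩
  · exact absurd rfl huv

theorem HasTwoColouring.of_equiv {V W : Type} (e : W ≃ V) (h : HasTwoColouring V) :
    HasTwoColouring W := by
  obtain ⟨A, ρ, hA, hρ, q, a, b, h⟩ := h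
  refine ⟨fun u v => A (e u) (e v), fun u v => ρ (e u) (e v),
    ⟨fun v => hA.1 _, fun u v huv => hA.2 _ _ (e.injective.ne huv)⟩, fun u v huv => ?_,
    e.symm q, e.symm a, e.symm b, by simpa using h⟩
  rcases hρ _ _ (e.injective.ne huv) with h | ⟨w, h⟩
  · exact Or.inl h
  · exact Or.inr ⟨e.symm w, by simpa using h⟩

theorem HasTwoColouring.of_table {n : ℕ} (M : Fin n → Fin n → Fin 3) (q a b : Fin n)
    (h₁ : ∀ v, M v v = 0) (h₂ : ∀ u v, u ≠ v → (M u v = 0 ↔ M v u ≠ 0))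
    (h₃ : ∀ u v, u ≠ v → M u v = 0 → ∃ w, M u w ≠ 0 ∧ M w v ≠ 0 ∧ M u w ≠ M w v)
    (hqa : M q a = 1) (hbq : M b q = 1) : HasTwoColouring (Fin n) := by
  refine ⟨fun u v => M u v ≠ 0, fun u v => decide (M u v = 2),
    ⟨fun v => by simp [h₁], fun u v huv => ?_⟩, fun u v huv => ?_, q, a, b, ?_⟩
  · have := h₂ u v huv
    simp only [Xor', Xor]
    tauto
  · by_cases h : M u v = 0
    · obtain ⟨w, ha, hb, hc⟩ := h₃ u v huv h
      have key : ∀ i j : Fin 3, i ≠ 0 → j ≠ 0 → i ≠ j → decide (i = 2) ≠ decide (j = 2) := by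
        decide
      exact Or.inr ⟨w, ha, hb, key _ _ ha hb hc⟩
    · exact Or.inl h
  · simp [hqa, hbq]

theorem hasTwoColouring_six : HasTwoColouring (Fin 6) := by
  refine .of_table
    ![![0, 0, 1, 0, 1, 2], ![2, 0, 0, 0, 0, 2], ![0, 2, 0, 1, 1, 0],
      ![2, 1, 0, 0, 2, 0], ![0, 1, 0, 0, 0, 2], ![0, 0, 1, 1, 0, 0]]
    2 3 0 ?_ ?_ ?_ ?_ ?_ <;> decide

theorem hasTwoColouring_seven : HasTwoColouring (Fin 7) := by
  refine .of_table
    ![![0, 0, 0, 0, 2, 1, 1], ![1, 0, 0, 2, 2, 0, 0], ![2, 2, 0, 2, 0, 0, 2],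
      ![2, 0, 0, 0, 1, 2, 0], ![0, 0, 1, 0, 0, 1, 1], ![0, 1, 1, 0, 0, 0, 0],
      ![0, 2, 0, 2, 0, 2, 0]]
    0 5 1 ?_ ?_ ?_ ?_ ?_ <;> decide

theorem hasTwoColouring_fin : ∀ n : ℕ, HasTwoColouring (Fin (n + 6))
  | 0 => hasTwoColouring_six
  | 1 => hasTwoColouring_seven
  | n + 2 => (hasTwoColouring_fin n).extend.of_equiv (Fintype.equivOfCardEq (by simp))

theorem exists_tournament_rc_eq (n k : ℕ) (hn : 6 ≤ n) (hk₁ : 2 ≤ k) (hk₂ : k ≤ n - 1) :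
    ∃ A : Fin n → Fin n → Prop, IsTournament A ∧ rc A = (k : ℕ∞) := by
  obtain rfl | hk := hk₁.eq_or_lt
  · obtain ⟨m, rfl⟩ := Nat.exists_eq_add_of_le' hn
    obtain ⟨A, ρ, hA, hρ, -⟩ := hasTwoColouring_fin m
    have : Nontrivial (Fin (m + 6)) := Fin.nontrivial_iff_two_le.2 (by omega)
    let ρ' : Fin (m + 6) → Fin (m + 6) → Fin 2 := fun u v => finTwoEquiv.symm (ρ u v)
    have hρ' : TwoStepRainbow A ρ' := fun u v huv => by simpa [ρ'] using hρ u v huv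
    exact ⟨A, hA, le_antisymm (rc_le_of_rainbowConnected ρ' (hρ'.rainbowConnected hA))
      hA.two_le_rc⟩
  · exact ⟨blowupArc n k, isTournament_blowupArc n k, rc_blowupArc hk hk₂⟩
end

section
/- For n ∈ {4, 5}, every tournament T on n vertices satisfies rc(T) ≥ 3. -/
lemma IsTournament.arc_or_arc {V : Type*} {A : V → V → Prop} (hT : IsTournament A) {u v : V}
    (huv : u ≠ v) : A u v ∨ A v u :=
  Xor.or (hT.2 u v huv)

lemma IsTournament.asymm {V : Type*} {A : V → V → Prop} (hT : IsTournament A) {u v : V}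
    (huv : A u v) : ¬ A v u := by
  have hne : u ≠ v := by rintro rfl; exact hT.1 _ huv
  exact fun hvu => (xor_iff_or_and_not_and _ _).1 (hT.2 u v hne) |>.2 ⟨huv, hvu⟩

/-- With at most two colours a rainbow path has at most two arcs, so every arc `u → v` lies on
a directed triangle whose other two arcs have different colours. -/
lemma RainbowConnected.exists_triangle {V : Type*} {A : V → V → Prop} (hT : IsTournament A)
    {c : ℕ} (hc : c ≤ 2) {ρ : V → V → Fin c} (h : RainbowConnected A ρ) {u v : V} (huv : A u v) :
    ∃ w, A v w ∧ A w u ∧ ρ v w ≠ ρ w u := by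
  have hne : u ≠ v := by rintro rfl; exact hT.1 _ huv
  have hvu : ¬ A v u := hT.asymm huv
  obtain ⟨l, hhead, hlast, ⟨hchain, -⟩, hcol⟩ := h v u
  have hlen : l.length - 1 ≤ 2 := by
    have := hcol.length_le_card
    simp [pathArcs] at this
    omega
  match l with
  | [] => simp at hhead
  | [a] => simp_all
  | [a, b] =>
    simp only [List.head?_cons, Option.some.injEq] at hhead
    simp at hlast
    subst hhead hlast
    change List.IsChain A _ at hchain
    simp_all
  | [a, b, d] =>
    simp only [List.head?_cons, Option.some.injEq] at hhead
    simp at hlast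
    subst hhead hlast
    simp [pathArcs] at hcol
    change List.IsChain A _ at hchain
    simp at hchain
    exact ⟨b, hchain.1, hchain.2, hcol⟩
  | a :: b :: d :: e :: l => simp at hlen

/-- `κ` is an arc-colouring of the asymmetric relation `A` in which every arc lies on a
directed triangle whose other two arcs have different colours. -/
structure TriangleCover {V : Type*} (A : V → V → Prop) (κ : V → V → Bool) : Prop where
  asymm : ∀ u v, A u v → ¬ A v u
  exists_triangle : ∀ u v, A u v → ∃ w, A v w ∧ A w u ∧ κ v w ≠ κ w u

namespace TriangleCover

variable {V : Type*} {A : V → V → Prop} {κ : V → V → Bool} {v a b c d : V}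

lemma reverse (h : TriangleCover A κ) :
    TriangleCover (fun u v => A v u) (fun u v => κ v u) where
  asymm u v := h.asymm v u
  exists_triangle u v huv := by
    obtain ⟨w, h1, h2, h3⟩ := h.exists_triangle v u huv
    exact ⟨w, h2, h1, h3.symm⟩

lemma comap {W : Type*} (h : TriangleCover A κ) (e : W ≃ V) :
    TriangleCover (fun u v => A (e u) (e v)) (fun u v => κ (e u) (e v)) where
  asymm u v := h.asymm (e u) (e v)
  exists_triangle u v huv := by
    obtain ⟨w, hw⟩ := h.exists_triangle (e u) (e v) huv
    exact ⟨e.symm w, by simpa using hw⟩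

lemma false_of_indegree_three_of_arc (h : TriangleCover A κ)
    (hV : ∀ t, t = v ∨ t = a ∨ t = b ∨ t = c ∨ t = d)
    (hb : A b v) (hc : A c v) (hd : A d v) (hbc : A b c) : False := by
  have hasymm := h.asymm
  have hout (t) (ht : A t v) : A a t := by
    obtain ⟨s, h1, h2, -⟩ := h.exists_triangle t v ht
    rcases hV s with rfl | rfl | rfl | rfl | rfl <;> grind
  have hab := hout b hb
  have hac := hout c hc
  have had := hout d hd
  have step (p q r) (hp : A p v) (hq : A q v)
      (hpqr : ∀ t, t = v ∨ t = a ∨ t = p ∨ t = q ∨ t = r) (hpq : A p q) :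
      A q r ∧ A r p ∧ κ q r ≠ κ r p := by
    have hap := hout p hp
    have haq := hout q hq
    obtain ⟨s, h1, h2, h3⟩ := h.exists_triangle p q hpq
    rcases hpqr s with rfl | rfl | rfl | rfl | rfl <;> grind
  obtain ⟨hcd, hdb, h1⟩ := step b c d hb hc hV hbc
  obtain ⟨-, -, h2⟩ := step c d b hc hd (fun t => by have := hV t; tauto) hcd
  obtain ⟨-, -, h3⟩ := step d b c hd hb (fun t => by have := hV t; tauto) hdb
  revert h1 h2 h3
  generalize κ b c = x, κ c d = y, κ d b = z
  decide +revert

lemma false_of_indegree_three (h : TriangleCover A κ) (htot : ∀ u v, u ≠ v → A u v ∨ A v u)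
    (hV : ∀ t, t = v ∨ t = a ∨ t = b ∨ t = c ∨ t = d) (hbc : b ≠ c)
    (hb : A b v) (hc : A c v) (hd : A d v) : False := by
  rcases htot b c hbc with hbc | hcb
  · exact h.false_of_indegree_three_of_arc hV hb hc hd hbc
  · exact h.false_of_indegree_three_of_arc (a := a) (d := d)
      (fun t => by have := hV t; tauto) hc hb hd hcb

lemma false_of_outdegree_three (h : TriangleCover A κ) (htot : ∀ u v, u ≠ v → A u v ∨ A v u)
    (hV : ∀ t, t = v ∨ t = a ∨ t = b ∨ t = c ∨ t = d) (hbc : b ≠ c)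
    (hb : A v b) (hc : A v c) (hd : A v d) : False :=
  h.reverse.false_of_indegree_three (fun u v huv => (htot u v huv).symm) hV hbc hb hc hd

/-- In the rotational tournament on five vertices, the arcs of the inner pentagon would have to
alternate in colour. -/
lemma false_of_rotational (h : TriangleCover A κ)
    (hV : ∀ t, t = v ∨ t = a ∨ t = b ∨ t = c ∨ t = d)
    (hva : A v a) (hab : A a b) (hbc : A b c) (hcd : A c d) (hdv : A d v)
    (hvb : A v b) (hac : A a c) (hbd : A b d) (hcv : A c v) (hda : A d a) : False := by
  have hasymm := h.asymm
  have step (p q r s t) (hV : ∀ x, x = p ∨ x = q ∨ x = r ∨ x = s ∨ x = t) (hpq : A p q)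
      (hpr : A p r) (hqr : A q r) (htp : A t p) (htq : A t q) : κ q s ≠ κ s p := by
    obtain ⟨x, h1, h2, h3⟩ := h.exists_triangle p q hpq
    rcases hV x with rfl | rfl | rfl | rfl | rfl <;> grind
  have h1 := step v a b c d hV hva hvb hab hdv hda
  have h2 := step a b c d v (fun t => by have := hV t; tauto) hab hac hbc hva hvb
  have h3 := step b c d v a (fun t => by have := hV t; tauto) hbc hbd hcd hab hac
  have h4 := step c d v a b (fun t => by have := hV t; tauto) hcd hcv hdv hbc hbd
  have h5 := step d v a b c (fun t => by have := hV t; tauto) hdv hda hva hcd hcv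
  revert h1 h2 h3 h4 h5
  generalize κ a c = x, κ c v = y, κ v b = z, κ b d = s, κ d a = t
  decide +revert

lemma false_of_outdegree_two_of_arcs (h : TriangleCover A κ)
    (htot : ∀ u v, u ≠ v → A u v ∨ A v u)
    (hV : ∀ t, t = v ∨ t = a ∨ t = b ∨ t = c ∨ t = d) (hdist : [v, a, b, c, d].Nodup)
    (hva : A v a) (hvb : A v b) (hcv : A c v) (hdv : A d v)
    (hab : A a b) (hcd : A c d) : False := by
  simp only [List.nodup_cons, List.mem_cons, List.not_mem_nil, or_false, not_or] at hdist
  obtain ⟨⟨hv1, hv2, hv3, hv4⟩, ⟨ha1, ha2, ha3⟩, ⟨hb1, hb2⟩, hcd', -⟩ := hdist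
  have hbc : A b c := (htot b c hb1).resolve_right fun hcb =>
    h.false_of_indegree_three (a := d) htot (fun t => by have := hV t; tauto) hv1 hvb hab hcb
  have hbd : A b d := (htot b d hb2).resolve_right fun hdb =>
    h.false_of_indegree_three (a := c) htot (fun t => by have := hV t; tauto) hv1 hvb hab hdb
  have hda : A d a := (htot a d ha3).resolve_left fun had =>
    h.false_of_indegree_three (a := v) htot (fun t => by have := hV t; tauto) hb1 hbd hcd had
  have hac : A a c := (htot a c ha2).resolve_right fun hca =>
    h.false_of_indegree_three (a := b) htot (fun t => by have := hV t; tauto) hv4 hva hda hca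
  exact h.false_of_rotational hV hva hab hbc hcd hdv hvb hac hbd hcv hda

lemma false_of_outdegree_two (h : TriangleCover A κ)
    (htot : ∀ u v, u ≠ v → A u v ∨ A v u)
    (hV : ∀ t, t = v ∨ t = a ∨ t = b ∨ t = c ∨ t = d) (hdist : [v, a, b, c, d].Nodup)
    (hva : A v a) (hvb : A v b) (hcv : A c v) (hdv : A d v) : False := by
  rcases htot a b (by grind) with hab | hba <;> rcases htot c d (by grind) with hcd | hdc
  · exact h.false_of_outdegree_two_of_arcs htot hV hdist hva hvb hcv hdv hab hcd
  · exact h.false_of_outdegree_two_of_arcs htot (fun t => by have := hV t; tauto) (by grind)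
      hva hvb hdv hcv hab hdc
  · exact h.false_of_outdegree_two_of_arcs htot (fun t => by have := hV t; tauto) (by grind)
      hvb hva hcv hdv hba hcd
  · exact h.false_of_outdegree_two_of_arcs htot (fun t => by have := hV t; tauto) (by grind)
      hvb hva hdv hcv hba hdc

lemma false_of_card_five {A : Fin 5 → Fin 5 → Prop} {κ : Fin 5 → Fin 5 → Bool}
    (h : TriangleCover A κ) (htot : ∀ u v, u ≠ v → A u v ∨ A v u) : False := by
  have two := fun a b c d hV hd => h.false_of_outdegree_two (v := 0) (a := a) (b := b) (c := c)
    (d := d) htot hV hd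
  have out := fun a b c d hV hd => h.false_of_outdegree_three (v := 0) (a := a) (b := b) (c := c)
    (d := d) htot hV hd
  have inn := fun a b c d hV hd => h.false_of_indegree_three (v := 0) (a := a) (b := b) (c := c)
    (d := d) htot hV hd
  have two1 := two 1 2 3 4 (by decide) (by decide)
  have two2 := two 1 3 2 4 (by decide) (by decide)
  have two3 := two 1 4 2 3 (by decide) (by decide)
  have two4 := two 2 3 1 4 (by decide) (by decide)
  have two5 := two 2 4 1 3 (by decide) (by decide)
  have two6 := two 3 4 1 2 (by decide) (by decide)
  have out1 := out 1 2 3 4 (by decide) (by decide)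
  have out2 := out 2 1 3 4 (by decide) (by decide)
  have out3 := out 3 1 2 4 (by decide) (by decide)
  have out4 := out 4 1 2 3 (by decide) (by decide)
  have in1 := inn 1 2 3 4 (by decide) (by decide)
  have in2 := inn 2 1 3 4 (by decide) (by decide)
  have in3 := inn 3 1 2 4 (by decide) (by decide)
  have in4 := inn 4 1 2 3 (by decide) (by decide)
  have h1 := htot 0 1 (by decide)
  have h2 := htot 0 2 (by decide)
  have h3 := htot 0 3 (by decide)
  have h4 := htot 0 4 (by decide)
  clear two out inn h htot
  grind

lemma false_of_card_four {A : Fin 4 → Fin 4 → Prop} {κ : Fin 4 → Fin 4 → Bool}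
    (h : TriangleCover A κ) (htot : ∀ u v, u ≠ v → A u v ∨ A v u) : False := by
  obtain ⟨hasymm, h⟩ := h
  simp [Fin.forall_fin_succ, Fin.exists_fin_succ] at h hasymm htot
  grind (splits := 100)

end TriangleCover

lemma RainbowConnected.triangleCover {V : Type*} {A : V → V → Prop} (hT : IsTournament A)
    {c : ℕ} (hc : c ≤ 2) {ρ : V → V → Fin c} (h : RainbowConnected A ρ) :
    TriangleCover A (fun u v => decide ((ρ u v).val = 0)) where
  asymm _ _ := hT.asymm
  exists_triangle u v huv := by
    obtain ⟨w, hvw, hwu, hne⟩ := h.exists_triangle hT hc huv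
    refine ⟨w, hvw, hwu, ?_⟩
    simp only [ne_eq, decide_eq_decide]
    omega

theorem rc_ge_three_of_card_four_or_five (V : Type) [Fintype V]
    (hn : Fintype.card V = 4 ∨ Fintype.card V = 5)
    (A : V → V → Prop) (hT : IsTournament A) :
    3 ≤ rc A := by
  refine le_sInf ?_
  rintro k ⟨c, rfl, ρ, hρ⟩
  by_contra! hk
  have hc : c < 3 := by exact_mod_cast hk
  have hcover := hρ.triangleCover hT (Nat.le_of_lt_succ hc)
  rcases hn with hn | hn
  · exact (hcover.comap (Fintype.equivFinOfCardEq hn).symm).false_of_card_four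
      fun i j hij => hT.arc_or_arc ((Equiv.injective _).ne hij)
  · exact (hcover.comap (Fintype.equivFinOfCardEq hn).symm).false_of_card_five
      fun i j hij => hT.arc_or_arc ((Equiv.injective _).ne hij)
end

section
/- For every integer k ≥ 3, the circulant digraph C_{2k+1}(S) with connection set S = {1, 2, 4, 6, ..., 2(k−1)} is a tournament on 2k+1 vertices, and its rainbow connection number equals 2. -/
/-- The arc relation of the circulant digraph with connection set
`{1, 2, 4, …, 2 (k - 1)}` on `ZMod (2 * k + 1)`. -/
def oddCirculantArc (k : ℕ) (i j : ZMod (2 * k + 1)) : Prop :=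
  ∃ s ∈ ({1} ∪ (Finset.Icc 1 (k - 1)).image (fun t => 2 * t) : Finset ℕ),
    j - i = (s : ZMod (2 * k + 1))

lemma natCast_inj_of_lt {n a b : ℕ} (ha : a < n) (hb : b < n) :
    (a : ZMod n) = b ↔ a = b := by
  rw [ZMod.natCast_eq_natCast_iff', Nat.mod_eq_of_lt ha, Nat.mod_eq_of_lt hb]

lemma oddCirculantArc_of_sub_eq {k m : ℕ} (hk : 3 ≤ k) {u v : ZMod (2 * k + 1)}
    (hm : m < 2 * k + 1) (h : v - u = m) :
    oddCirculantArc k u v ↔ m = 1 ∨ (m % 2 = 0 ∧ 2 ≤ m ∧ m + 2 ≤ 2 * k) := by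
  unfold oddCirculantArc
  simp only [Finset.mem_union, Finset.mem_singleton, Finset.mem_image, Finset.mem_Icc, h]
  constructor
  · rintro ⟨s, hs | ⟨t, ht, rfl⟩, hms⟩ <;>
      rw [natCast_inj_of_lt hm (by omega)] at hms <;> omega
  · rintro (rfl | hm')
    · exact ⟨1, Or.inl rfl, rfl⟩
    · exact ⟨m, Or.inr ⟨m / 2, by omega, by omega⟩, rfl⟩

lemma exists_natCast_eq {k : ℕ} (d : ZMod (2 * k + 1)) :
    ∃ m : ℕ, m < 2 * k + 1 ∧ d = m :=
  ⟨d.val, ZMod.val_lt d, (ZMod.natCast_zmod_val d).symm⟩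

lemma not_oddCirculantArc_self {k : ℕ} (hk : 3 ≤ k) (v : ZMod (2 * k + 1)) :
    ¬ oddCirculantArc k v v := by
  rw [oddCirculantArc_of_sub_eq (m := 0) hk (by omega) (by simp)]
  omega

lemma isTournament_oddCirculantArc {k : ℕ} (hk : 3 ≤ k) :
    IsTournament (oddCirculantArc k) := by
  refine ⟨not_oddCirculantArc_self hk, fun u v huv => ?_⟩
  obtain ⟨m, hm, h⟩ := exists_natCast_eq (v - u)
  have hm0 : m ≠ 0 := by
    rintro rfl
    exact huv (sub_eq_zero.mp (by simpa using h)).symm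
  have h' : u - v = ((2 * k + 1 - m : ℕ) : ZMod (2 * k + 1)) := by
    rw [Nat.cast_sub hm.le, ZMod.natCast_self, ← h]
    ring
  rw [oddCirculantArc_of_sub_eq hk hm h, oddCirculantArc_of_sub_eq hk (by omega) h']
  refine xor_def.2 ?_
  omega

section RainbowPaths

variable {V C : Type*} {A : V → V → Prop} {ρ : V → V → C}

lemma isDipath_iff {l : List V} : IsDipath A l ↔ l.IsChain A ∧ l.Nodup := Iff.rfl

lemma exists_rainbowPath_refl (u : V) :
    ∃ l : List V, l.head? = some u ∧ l.getLast? = some u ∧ IsRainbowPath A ρ l :=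
  ⟨[u], by simp [IsRainbowPath, isDipath_iff, pathArcs]⟩

lemma exists_rainbowPath_of_arc {u v : V} (huv : u ≠ v) (h : A u v) :
    ∃ l : List V, l.head? = some u ∧ l.getLast? = some v ∧ IsRainbowPath A ρ l :=
  ⟨[u, v], by simp [IsRainbowPath, isDipath_iff, pathArcs, huv, h]⟩

lemma exists_rainbowPath_of_two_arcs (hA : ∀ x, ¬ A x x) {u v : V} (w : V) (huv : u ≠ v)
    (huw : A u w) (hwv : A w v) (hρ : ρ u w ≠ ρ w v) :
    ∃ l : List V, l.head? = some u ∧ l.getLast? = some v ∧ IsRainbowPath A ρ l := by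
  have h1 : u ≠ w := by rintro rfl; exact hA _ huw
  have h2 : w ≠ v := by rintro rfl; exact hA _ hwv
  exact ⟨[u, w, v], by simp [IsRainbowPath, isDipath_iff, pathArcs, huv, huw, hwv, hρ, h1, h2]⟩

/-- With at most one colour, rainbow connectedness forces every ordered pair of distinct
vertices to be an arc. -/
lemma RainbowConnected.arc_of_subsingleton [Subsingleton C] (h : RainbowConnected A ρ)
    {u v : V} (huv : u ≠ v) : A u v := by
  obtain ⟨l, hu, hv, hl, hρ⟩ := h u v
  match l with
  | [] => simp at hu
  | [a] => simp_all
  | [a, b] =>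
    simp only [List.head?_cons, Option.some.injEq, List.getLast?_cons_cons,
      List.getLast?_singleton] at hu hv
    subst hu hv
    simpa using (isDipath_iff.1 hl).1
  | a :: b :: c :: l =>
    simp only [pathArcs, List.tail_cons, List.zip_cons_cons, List.map_cons, List.nodup_cons,
      List.mem_cons, not_or] at hρ
    exact absurd (Subsingleton.elim _ _) hρ.1.1

end RainbowPaths

/-- The arcs receiving the first of the two colours: those of length `1`, those of length `2`
from a vertex in `{0, 2, …, 2 k - 2}`, and the arc of length `2 k - 2` from the vertex `1`. -/
def IsRedArc (k : ℕ) (u v : ZMod (2 * k + 1)) : Prop :=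
  v - u = 1 ∨ (v - u = 2 ∧ Even u.val ∧ u.val < 2 * k) ∨
    (v - u = ((2 * k - 2 : ℕ) : ZMod (2 * k + 1)) ∧ u = 1)

lemma isRedArc_natCast_iff {k a m : ℕ} (hk : 3 ≤ k) {u v : ZMod (2 * k + 1)}
    (ha : a < 2 * k + 1) (hm : m < 2 * k + 1) (hu : u = a) (h : v - u = m) :
    IsRedArc k u v ↔
      m = 1 ∨ (m = 2 ∧ a % 2 = 0 ∧ a < 2 * k) ∨ (m + 2 = 2 * k ∧ a = 1) := by
  have h1 : (m : ZMod (2 * k + 1)) = 1 ↔ m = 1 := by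
    exact_mod_cast natCast_inj_of_lt hm (b := 1) (by omega)
  have h2 : (m : ZMod (2 * k + 1)) = 2 ↔ m = 2 := by
    exact_mod_cast natCast_inj_of_lt hm (b := 2) (by omega)
  have h3 : (a : ZMod (2 * k + 1)) = 1 ↔ a = 1 := by
    exact_mod_cast natCast_inj_of_lt ha (b := 1) (by omega)
  rw [IsRedArc, h, hu, h1, h2, h3, natCast_inj_of_lt hm (by omega), ZMod.val_natCast_of_lt ha,
    Nat.even_iff]
  omega

open Classical in
/-- The two-colouring of arcs whose first colour class is `IsRedArc`. -/
noncomputable def redArcColouring (k : ℕ) (u v : ZMod (2 * k + 1)) : Fin 2 :=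
  if IsRedArc k u v then 0 else 1

lemma redArcColouring_ne {k : ℕ} {u w v : ZMod (2 * k + 1)}
    (h : ¬ (IsRedArc k u w ↔ IsRedArc k w v)) :
    redArcColouring k u w ≠ redArcColouring k w v := by
  unfold redArcColouring
  by_cases h1 : IsRedArc k u w <;> by_cases h2 : IsRedArc k w v <;> simp_all

/-- A two-arc path, described by the residues `a`, `b` of its first two vertices and the lengths
`s`, `t` of its arcs, is rainbow if exactly one of its arcs is red. -/
lemma exists_rainbowPath_of_residues {k a b s t : ℕ} (hk : 3 ≤ k) {u v : ZMod (2 * k + 1)}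
    (huv : u ≠ v) (hu : u = a) (ha : a < 2 * k + 1) (hb : b < 2 * k + 1)
    (hab : a + s = b ∨ a + s = b + (2 * k + 1)) (hv : v = ((a + s + t : ℕ) : ZMod (2 * k + 1)))
    (hs : s = 1 ∨ (s % 2 = 0 ∧ 2 ≤ s ∧ s + 2 ≤ 2 * k))
    (ht : t = 1 ∨ (t % 2 = 0 ∧ 2 ≤ t ∧ t + 2 ≤ 2 * k))
    (hne : ¬ ((s = 1 ∨ (s = 2 ∧ a % 2 = 0 ∧ a < 2 * k) ∨ (s + 2 = 2 * k ∧ a = 1)) ↔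
      (t = 1 ∨ (t = 2 ∧ b % 2 = 0 ∧ b < 2 * k) ∨ (t + 2 = 2 * k ∧ b = 1)))) :
    ∃ l : List (ZMod (2 * k + 1)), l.head? = some u ∧ l.getLast? = some v ∧
      IsRainbowPath (oddCirculantArc k) (redArcColouring k) l := by
  have hb' : ((a + s : ℕ) : ZMod (2 * k + 1)) = b := by
    rcases hab with h | h <;> rw [h]
    rw [Nat.cast_add, ZMod.natCast_self, add_zero]
  have h1 : (b : ZMod (2 * k + 1)) - u = s := by
    rw [← hb', hu]; push_cast; ring
  have h2 : v - (b : ZMod (2 * k + 1)) = t := by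
    rw [← hb', hv]; push_cast; ring
  refine exists_rainbowPath_of_two_arcs (not_oddCirculantArc_self hk) (b : ZMod (2 * k + 1)) huv
    ((oddCirculantArc_of_sub_eq hk (by omega) h1).2 hs)
    ((oddCirculantArc_of_sub_eq hk (by omega) h2).2 ht) (redArcColouring_ne ?_)
  rwa [isRedArc_natCast_iff hk ha (by omega) hu h1, isRedArc_natCast_iff hk hb (by omega) rfl h2]

lemma rainbowConnected_redArcColouring {k : ℕ} (hk : 3 ≤ k) :
    RainbowConnected (oddCirculantArc k) (redArcColouring k) := by
  intro u v
  by_cases huv : u = v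
  · exact huv ▸ exists_rainbowPath_refl u
  by_cases harc : oddCirculantArc k u v
  · exact exists_rainbowPath_of_arc huv harc
  obtain ⟨m, hm, h⟩ := exists_natCast_eq (v - u)
  obtain ⟨a, ha, hu⟩ := exists_natCast_eq u
  have hm0 : m ≠ 0 := by
    rintro rfl
    exact huv (sub_eq_zero.mp (by simpa using h)).symm
  rw [oddCirculantArc_of_sub_eq hk hm h] at harc
  have hv : ∀ s t : ℕ, s + t = m ∨ s + t = m + (2 * k + 1) →
      v = ((a + s + t : ℕ) : ZMod (2 * k + 1)) := by
    intro s t hst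
    have hst' : ((s + t : ℕ) : ZMod (2 * k + 1)) = m := by
      rcases hst with h | h <;> rw [h]
      rw [Nat.cast_add, ZMod.natCast_self, add_zero]
    rw [add_assoc, Nat.cast_add, hst', ← h, ← hu]
    ring
  have path := fun b s t ha hb hab hst => exists_rainbowPath_of_residues (a := a) (b := b)
    (s := s) (t := t) hk huv hu ha hb hab (hv s t hst)
  by_cases hm2 : m = 2 * k
  · by_cases ha2 : a = 2 * k
    · exact path 1 2 (2 * k - 2) ha (by omega) (by omega) (by omega) (by omega) (by omega)
        (by omega)
    by_cases hpar : a % 2 = 0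
    · exact path (a + 2) 2 (2 * k - 2) ha (by omega) (by omega) (by omega) (by omega) (by omega)
        (by omega)
    by_cases ha1 : a = 1
    · exact path (2 * k - 1) (2 * k - 2) 2 ha (by omega) (by omega) (by omega) (by omega)
        (by omega) (by omega)
    · exact path (a - 3) (2 * k - 2) 2 ha (by omega) (by omega) (by omega) (by omega)
        (by omega) (by omega)
  · by_cases ha2 : a = 2 * k
    · exact path (m - 2) (m - 1) 1 ha (by omega) (by omega) (by omega) (by omega) (by omega)
        (by omega)
    by_cases hred : (m - 1 = 2 ∧ (a + 1) % 2 = 0 ∧ a + 1 < 2 * k) ∨ (m + 1 = 2 * k ∧ a = 0)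
    · obtain hlt | hge := lt_or_ge (a + (m - 1)) (2 * k + 1)
      · exact path (a + (m - 1)) (m - 1) 1 ha hlt (by omega) (by omega) (by omega) (by omega)
          (by omega)
      · exact path (a + (m - 1) - (2 * k + 1)) (m - 1) 1 ha (by omega) (by omega) (by omega)
          (by omega) (by omega) (by omega)
    · exact path (a + 1) 1 (m - 1) ha (by omega) (by omega) (by omega) (by omega) (by omega)
        (by omega)

lemma rc_oddCirculantArc {k : ℕ} (hk : 3 ≤ k) : rc (oddCirculantArc k) = 2 := by
  apply le_antisymm
  · exact sInf_le ⟨2, rfl, redArcColouring k, rainbowConnected_redArcColouring hk⟩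
  · refine le_sInf ?_
    rintro _ ⟨c, rfl, ρ, hρ⟩
    by_contra hc
    have hc2 : c < 2 := by exact_mod_cast not_le.mp hc
    have : Subsingleton (Fin c) := Fin.subsingleton_iff_le_one.2 (by omega)
    have h0 : ((2 * k : ℕ) : ZMod (2 * k + 1)) - 0 = ((2 * k : ℕ) : ZMod (2 * k + 1)) :=
      sub_zero _
    have hne : (0 : ZMod (2 * k + 1)) ≠ ((2 * k : ℕ) : ZMod (2 * k + 1)) := by
      have := (natCast_inj_of_lt (n := 2 * k + 1) (a := 0) (b := 2 * k) (by omega)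
        (by omega)).not.2 (by omega)
      rwa [Nat.cast_zero] at this
    have := hρ.arc_of_subsingleton hne
    rw [oddCirculantArc_of_sub_eq hk (by omega) h0] at this
    omega

theorem circulant_odd_tournament_rc_two (k : ℕ) (hk : 3 ≤ k) :
    Nat.card (ZMod (2 * k + 1)) = 2 * k + 1 ∧
    IsTournament (fun i j : ZMod (2 * k + 1) =>
      ∃ s ∈ ({1} ∪ (Finset.Icc 1 (k - 1)).image (fun t => 2 * t) : Finset ℕ),
        j - i = (s : ZMod (2 * k + 1))) ∧
    rc (fun i j : ZMod (2 * k + 1) =>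
      ∃ s ∈ ({1} ∪ (Finset.Icc 1 (k - 1)).image (fun t => 2 * t) : Finset ℕ),
        j - i = (s : ZMod (2 * k + 1))) = 2 := by
  exact ⟨Nat.card_zmod _, isTournament_oddCirculantArc hk, rc_oddCirculantArc hk⟩
end

section
/- There exists a tournament T on 6 vertices whose rainbow connection number equals 2. -/
/-- An arc is a rainbow path of length one, and two consecutive arcs of different colours
form a rainbow path of length two; if these join all pairs of distinct vertices, then the
digraph is rainbow connected. -/
theorem RainbowConnected.of_adj_or_exists {V C : Type*} {A : V → V → Prop} {ρ : V → V → C}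
    (h : ∀ u v : V, u ≠ v → A u v ∨
      ∃ w, A u w ∧ A w v ∧ u ≠ w ∧ w ≠ v ∧ ρ u w ≠ ρ w v) :
    RainbowConnected A ρ := by
  intro u v
  by_cases huv : u = v
  · subst huv
    exact ⟨[u], by simp [IsRainbowPath, IsDipath, pathArcs, List.Chain']⟩
  · rcases h u v huv with huv' | ⟨w, huw, hwv, hu, hv, hρ⟩
    · exact ⟨[u, v], by simp_all [IsRainbowPath, IsDipath, pathArcs, List.Chain']⟩
    · exact ⟨[u, w, v], by simp_all [IsRainbowPath, IsDipath, pathArcs, List.Chain']⟩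

/-- The adjacency matrix of a tournament on six vertices. -/
def sixTournament : Fin 6 → Fin 6 → Bool :=
  ![![false, true, false, false, true, true],
    ![false, false, true, true, false, true],
    ![true, false, false, true, false, false],
    ![true, false, false, false, true, true],
    ![false, true, true, false, false, false],
    ![false, false, true, false, true, false]]

/-- A rainbow colouring of `sixTournament` with two colours. -/
def sixColouring : Fin 6 → Fin 6 → Fin 2 :=
  ![![0, 0, 0, 0, 1, 0],
    ![0, 0, 0, 1, 0, 0],
    ![1, 0, 0, 1, 0, 0],
    ![0, 0, 0, 0, 0, 1],
    ![0, 1, 0, 0, 0, 0],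
    ![0, 0, 0, 0, 0, 0]]

theorem exists_tournament_six_rc_two :
    ∃ A : Fin 6 → Fin 6 → Prop, IsTournament A ∧ rc A = 2 := by
  refine ⟨fun u v => sixTournament u v = true, ⟨by decide, ?_⟩, le_antisymm ?_ ?_⟩
  · unfold Xor'
    decide
  · exact sInf_le ⟨2, rfl, sixColouring, .of_adj_or_exists (by decide)⟩
  · refine le_sInf ?_
    rintro _ ⟨c, rfl, ρ, hρ⟩
    by_contra! hc
    have hc' : c < 2 := by exact_mod_cast hc
    have : Subsingleton (Fin c) := Fin.subsingleton_iff_le_one.mpr (by omega)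
    exact absurd (hρ.adj_of_subsingleton (u := 0) (v := 2) (by decide)) (by decide)
end
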